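/- Let Ω be a finite probability space, X a nonempty finite set with |X| = N, and S a finite set. Let Z : Ω → (X → {0,1}) be a random variable whose law is the uniform distribution on the set of all functions from X to {0,1}, let W : Ω → S be any random variable, and let g : S → (X → {0,1}) be any prediction function. Then the average prediction success probability satisfies (1/N) · Σ_{x ∈ X} Pr[g(W)(x) = Z(x)] ≤ 1/2 + √( I(Z : W) / (2N) ), where I(Z : W) is the mutual information between Z and W in nats. -/

import Mathlib

open Finset

open scoped Classical

/-- Probability of an event `E` under the weight function `μ` on a finite sample space. -/
noncomputable def prob {Ω : Type*} [Fintype Ω] (μ : Ω → ℝ) (E : Ω → Prop) : ℝ :=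
  ∑ ω, if E ω then μ ω else 0

/-- Shannon entropy (in nats) of a finitely-valued random variable `V`. -/
noncomputable def entropy {Ω α : Type*} [Fintype Ω] [Fintype α]
    (μ : Ω → ℝ) (V : Ω → α) : ℝ :=
  -∑ a, prob μ (fun ω => V ω = a) * Real.log (prob μ (fun ω => V ω = a))

/-- Conditional Shannon entropy (in nats) `H(V | W) = ∑_b P[W = b] · H(V | W = b)`. -/
noncomputable def condEntropy {Ω α β : Type*} [Fintype Ω] [Fintype α] [Fintype β]
    (μ : Ω → ℝ) (V : Ω → α) (W : Ω → β) : ℝ :=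
  ∑ b, prob μ (fun ω => W ω = b) *
    (-∑ a, (prob μ (fun ω => V ω = a ∧ W ω = b) / prob μ (fun ω => W ω = b)) *
        Real.log (prob μ (fun ω => V ω = a ∧ W ω = b) / prob μ (fun ω => W ω = b)))

/-- Mutual information (in nats) `I(V : W) = H(V) − H(V | W)`. -/
noncomputable def mutualInfo {Ω α β : Type*} [Fintype Ω] [Fintype α] [Fintype β]
    (μ : Ω → ℝ) (V : Ω → α) (W : Ω → β) : ℝ :=
  entropy μ V - condEntropy μ V W

/-- The centred agreement score between two Boolean values. -/
noncomputable def agreement (a b : Bool) : ℝ := if a = b then 1 / 2 else -1 / 2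

/-- Moment generating function bound for the total agreement with a uniformly random function. -/
lemma sum_exp_agreement_le {X : Type*} [Fintype X] (h : X → Bool) (t : ℝ) :
    ∑ f : X → Bool, Real.exp (t * ∑ x, agreement (h x) (f x)) ≤
      2 ^ Fintype.card X * Real.exp (Fintype.card X * t ^ 2 / 8) := by
  have one_coord (a : Bool) :
      ∑ v : Bool, Real.exp (t * agreement a v) = 2 * Real.cosh (t / 2) := by
    rw [Real.cosh_eq]
    cases a <;> simp [agreement] <;> ring_nf
  calc ∑ f : X → Bool, Real.exp (t * ∑ x, agreement (h x) (f x))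
      = ∑ f : X → Bool, ∏ x, Real.exp (t * agreement (h x) (f x)) := by
        simp only [Finset.mul_sum, Real.exp_sum]
    _ = ∏ x, ∑ v : Bool, Real.exp (t * agreement (h x) v) := by
        rw [Finset.prod_univ_sum, Fintype.piFinset_univ]
    _ = 2 ^ Fintype.card X * Real.cosh (t / 2) ^ Fintype.card X := by
        simp only [one_coord, Finset.prod_const, Finset.card_univ, mul_pow]
    _ ≤ 2 ^ Fintype.card X * Real.exp ((t / 2) ^ 2 / 2) ^ Fintype.card X := by
        gcongr
        exact Real.cosh_le_exp_half_sq _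
    _ = 2 ^ Fintype.card X * Real.exp (Fintype.card X * t ^ 2 / 8) := by
        rw [← Real.exp_nat_mul]
        ring_nf

/-- Pointwise form of the Gibbs inequality, with `exp s` as reference weight. -/
lemma mul_add_sub_exp_le_mul_log {p : ℝ} (hp : 0 ≤ p) (s : ℝ) :
    p * s + p - Real.exp s ≤ p * Real.log p := by
  rcases hp.eq_or_lt with rfl | hp
  · simpa using (Real.exp_pos s).le
  · have key := Real.add_one_le_exp (s - Real.log p)
    rw [Real.exp_sub, Real.exp_log hp, le_div_iff₀ hp] at key
    linarith

/-- A distribution on Boolean functions that agrees with a fixed function has small entropy. -/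
lemma neg_sum_mul_log_le_sub_agreement {X : Type*} [Fintype X] (h : X → Bool)
    (r : (X → Bool) → ℝ) (hr : ∀ f, 0 ≤ r f) (hr1 : ∑ f, r f = 1) (t : ℝ) :
    -∑ f, r f * Real.log (r f) ≤ Fintype.card X * Real.log 2 + Fintype.card X * t ^ 2 / 8 -
      t * ∑ f, r f * ∑ x, agreement (h x) (f x) := by
  set c : ℝ := Fintype.card X * Real.log 2 + Fintype.card X * t ^ 2 / 8 with hc
  have gibbs := Finset.sum_le_sum fun f (_ : f ∈ Finset.univ) =>
    mul_add_sub_exp_le_mul_log (hr f) (t * ∑ x, agreement (h x) (f x) - c)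
  have mass : ∑ f : X → Bool, Real.exp (t * ∑ x, agreement (h x) (f x) - c) ≤ 1 := by
    simp only [Real.exp_sub, ← Finset.sum_div]
    rw [div_le_one (Real.exp_pos _), hc, Real.exp_add, Real.exp_nat_mul,
      Real.exp_log (by norm_num)]
    exact sum_exp_agreement_le h t
  have expand : ∑ f, r f * (t * ∑ x, agreement (h x) (f x) - c) =
      t * (∑ f, r f * ∑ x, agreement (h x) (f x)) - c := by
    simp only [mul_sub, Finset.sum_sub_distrib, ← Finset.sum_mul, hr1, one_mul]
    rw [Finset.mul_sum]
    congr 1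
    exact Finset.sum_congr rfl fun _ _ => by ring
  rw [Finset.sum_sub_distrib, Finset.sum_add_distrib, expand, hr1] at gibbs
  linarith

lemma prob_nonneg {Ω : Type*} [Fintype Ω] {μ : Ω → ℝ} (hμ : ∀ ω, 0 ≤ μ ω) (E : Ω → Prop) :
    0 ≤ prob μ E :=
  Finset.sum_nonneg fun ω _ => by split_ifs <;> simp [hμ]

lemma sum_prob_mul {Ω α : Type*} [Fintype Ω] [Fintype α] (μ : Ω → ℝ) (V : Ω → α) (φ : α → ℝ) :
    ∑ a, prob μ (fun ω => V ω = a) * φ a = ∑ ω, μ ω * φ (V ω) := by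
  simp only [prob, Finset.sum_mul]
  rw [Finset.sum_comm]
  simp [ite_mul]

lemma sum_prob_and_mul {Ω α β : Type*} [Fintype Ω] [Fintype α] [Fintype β] (μ : Ω → ℝ)
    (V : Ω → α) (W : Ω → β) (φ : α → β → ℝ) :
    ∑ b, ∑ a, prob μ (fun ω => V ω = a ∧ W ω = b) * φ a b = ∑ ω, μ ω * φ (V ω) (W ω) := by
  rw [← sum_prob_mul μ (fun ω => (V ω, W ω)) (fun q => φ q.1 q.2), Fintype.sum_prod_type_right]
  simp only [Prod.mk.injEq]

lemma sum_prob_and {Ω α β : Type*} [Fintype Ω] [Fintype α] (μ : Ω → ℝ)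
    (V : Ω → α) (W : Ω → β) (b : β) :
    ∑ a, prob μ (fun ω => V ω = a ∧ W ω = b) = prob μ (fun ω => W ω = b) := by
  simp only [prob]
  rw [Finset.sum_comm]
  exact Finset.sum_congr rfl fun ω _ => by by_cases h : W ω = b <;> simp [h]

/-- Upper bound on the conditional entropy of a random Boolean function in terms of how well it is
predicted. -/
lemma condEntropy_le_sub_agreement {Ω X S : Type*} [Fintype Ω] [Fintype X] [Fintype S]
    (μ : Ω → ℝ) (hμ0 : ∀ ω, 0 ≤ μ ω) (hμ1 : ∑ ω, μ ω = 1) (Z : Ω → X → Bool) (W : Ω → S)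
    (g : S → X → Bool) (t : ℝ) :
    condEntropy μ Z W ≤ Fintype.card X * Real.log 2 + Fintype.card X * t ^ 2 / 8 -
      t * ∑ ω, μ ω * ∑ x, agreement (g (W ω) x) (Z ω x) := by
  set c : ℝ := Fintype.card X * Real.log 2 + Fintype.card X * t ^ 2 / 8
  have fibre (b : S) :
      prob μ (fun ω => W ω = b) *
        (-∑ a, (prob μ (fun ω => Z ω = a ∧ W ω = b) / prob μ (fun ω => W ω = b)) *
          Real.log (prob μ (fun ω => Z ω = a ∧ W ω = b) / prob μ (fun ω => W ω = b))) ≤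
      prob μ (fun ω => W ω = b) * c -
        t * ∑ f, prob μ (fun ω => Z ω = f ∧ W ω = b) * ∑ x, agreement (g b x) (f x) := by
    have total := sum_prob_and μ Z W b
    have nonneg (f : X → Bool) := prob_nonneg hμ0 (fun ω => Z ω = f ∧ W ω = b)
    rcases (prob_nonneg hμ0 (fun ω => W ω = b)).eq_or_lt with hb | hb
    · rw [← hb, Finset.sum_eq_zero_iff_of_nonneg fun f _ => nonneg f] at total
      simp [← hb, fun f => total f (Finset.mem_univ f)]
    · have bound := neg_sum_mul_log_le_sub_agreement (g b)
        (fun f => prob μ (fun ω => Z ω = f ∧ W ω = b) / prob μ (fun ω => W ω = b))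
        (fun f => div_nonneg (nonneg f) hb.le)
        (by rw [← Finset.sum_div, total, div_self hb.ne']) t
      refine (mul_le_mul_of_nonneg_left bound hb.le).trans_eq ?_
      simp only [div_mul_eq_mul_div, ← Finset.sum_div]
      rw [mul_sub, mul_left_comm, mul_div_cancel₀ _ hb.ne']
  refine (Finset.sum_le_sum fun b _ => fibre b).trans_eq ?_
  have h1 := sum_prob_mul μ W fun _ => c
  have h2 := sum_prob_and_mul μ Z W fun f b => ∑ x, agreement (g b x) (f x)
  rw [Finset.sum_sub_distrib, h1, ← Finset.mul_sum, h2, ← Finset.sum_mul, hμ1, one_mul]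

lemma sum_prob_eq_half_add_agreement {Ω X : Type*} [Fintype Ω] [Fintype X]
    (μ : Ω → ℝ) (hμ1 : ∑ ω, μ ω = 1) (Y Z : Ω → X → Bool) :
    ∑ x, prob μ (fun ω => Y ω x = Z ω x) =
      Fintype.card X / 2 + ∑ ω, μ ω * ∑ x, agreement (Y ω x) (Z ω x) := by
  have pointwise (ω : Ω) (x : X) [Decidable (Y ω x = Z ω x)] :
      (if Y ω x = Z ω x then μ ω else 0) = μ ω * (1 / 2) + μ ω * agreement (Y ω x) (Z ω x) := by
    by_cases h : Y ω x = Z ω x <;> simp [agreement, h] <;> ring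
  simp only [prob, pointwise]
  rw [Finset.sum_comm]
  simp only [Finset.sum_add_distrib, ← Finset.mul_sum, ← Finset.sum_mul, hμ1]
  simp
  ring

lemma entropy_eq_of_uniform {Ω X : Type*} [Fintype Ω] [Fintype X] (μ : Ω → ℝ) (Z : Ω → X → Bool)
    (hZ : ∀ f, prob μ (fun ω => Z ω = f) = 1 / 2 ^ Fintype.card X) :
    entropy μ Z = Fintype.card X * Real.log 2 := by
  simp [entropy, hZ]

theorem stmt_1 {Ω X S : Type*} [Fintype Ω] [Fintype X] [Nonempty X] [Fintype S]
    (μ : Ω → ℝ) (hμ0 : ∀ ω, 0 ≤ μ ω) (hμ1 : ∑ ω, μ ω = 1)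
    (N : ℕ) (hN : Fintype.card X = N)
    (Z : Ω → X → Bool) (W : Ω → S)
    (hZ : ∀ f : X → Bool, prob μ (fun ω => Z ω = f) = 1 / 2 ^ N)
    (g : S → X → Bool) :
    (1 / (N : ℝ)) * ∑ x : X, prob μ (fun ω => g (W ω) x = Z ω x) ≤
      1 / 2 + Real.sqrt (mutualInfo μ Z W / (2 * N)) := by
  subst hN
  have hn : (0 : ℝ) < Fintype.card X := by exact_mod_cast Fintype.card_pos
  rw [sum_prob_eq_half_add_agreement μ hμ1 (fun ω => g (W ω)) Z]
  set A : ℝ := ∑ ω, μ ω * ∑ x, agreement (g (W ω) x) (Z ω x)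
  set n : ℝ := (Fintype.card X : ℝ)
  have bound : A / n * 4 * A - n * (A / n * 4) ^ 2 / 8 ≤ mutualInfo μ Z W := by
    have := condEntropy_le_sub_agreement μ hμ0 hμ1 Z W g (A / n * 4)
    rw [mutualInfo, entropy_eq_of_uniform μ Z hZ]
    linarith
  have square : (A / n) ^ 2 ≤ mutualInfo μ Z W / (2 * n) := by
    rw [le_div_iff₀ (by positivity)]
    refine le_of_eq_of_le ?_ bound
    field_simp
    ring
  have split : 1 / n * (n / 2 + A) = 1 / 2 + A / n := by
    field_simp
  rw [split]
  gcongr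
  exact Real.le_sqrt_of_sq_le square
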